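/- arXiv:2112.05344 — 3 statements merged into one kernel-verified Lean document; each statement's English description precedes it below -/
import Mathlib

section
/- Let G be a finite simple graph, let L : V → ℕ be an injective labeling of its vertices, let v be a vertex, and let D = {u ∈ N(v) : L(u) < L(v)} be the set of neighbors of v with smaller label. Then there exists a set M ⊆ D such that: (i) the vertices of M are pairwise non-adjacent in G; (ii) every u ∈ D \ M has a neighbor w ∈ M with L(w) > L(u). Moreover, if G has neighborhood independence at most K, then |M| ≤ K. -/
/-- Every finite set of vertices contains an independent set that dominates the remaining vertices
by vertices of larger label. -/
theorem SimpleGraph.exists_indep_dominating_subset {V α : Type*} [LinearOrder α]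
    (G : SimpleGraph V) {L : V → α} (hL : Function.Injective L) (D : Finset V) :
    ∃ M ⊆ D, (∀ a ∈ M, ∀ b ∈ M, a ≠ b → ¬ G.Adj a b) ∧
      ∀ u ∈ D, u ∉ M → ∃ w ∈ M, G.Adj u w ∧ L u < L w := by
  classical
  induction D using Finset.induction_on_min_value L with
  | empty => exact ⟨∅, by simp⟩
  | insert a s ha hmin ih =>
    obtain ⟨M, hMs, hind, hdom⟩ := ih
    by_cases h : ∃ w ∈ M, G.Adj a w
    · obtain ⟨w, hw, haw⟩ := h
      refine ⟨M, hMs.trans (Finset.subset_insert a s), hind, fun u hu huM => ?_⟩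
      obtain rfl | hu := Finset.mem_insert.mp hu
      · exact ⟨w, hw, haw, (hmin w (hMs hw)).lt_of_ne (hL.ne haw.ne)⟩
      · exact hdom u hu huM
    · push Not at h
      refine ⟨insert a M, Finset.insert_subset_insert a hMs, ?_, fun u hu huM => ?_⟩
      · intro b hb c hc hbc
        rcases Finset.mem_insert.mp hb with rfl | hbM <;>
          rcases Finset.mem_insert.mp hc with rfl | hcM
        · exact absurd rfl hbc
        · exact h c hcM
        · exact fun hadj => h b hbM hadj.symm
        · exact hind b hbM c hcM hbc
      · obtain ⟨hua, huM⟩ := not_or.mp (mt Finset.mem_insert.mpr huM)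
        obtain ⟨w, hw, huw⟩ := hdom u (Finset.mem_of_mem_insert_of_ne hu hua) huM
        exact ⟨w, Finset.mem_insert_of_mem hw, huw⟩

/-- Greedy parent selection: among the lower-labeled neighbors `D` of a vertex `v`
there is an independent set `M` dominating `D` by higher labels; if `G` has
neighborhood independence at most `K`, then `|M| ≤ K`. -/
theorem stmt_1 {V : Type*} [Fintype V] (G : SimpleGraph V) [DecidableRel G.Adj]
    (L : V → ℕ) (hL : Function.Injective L) (v : V)
    (D : Finset V) (hD : D = (G.neighborFinset v).filter (fun u => L u < L v)) :
    ∃ M : Finset V, M ⊆ D ∧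
      (∀ a ∈ M, ∀ b ∈ M, a ≠ b → ¬ G.Adj a b) ∧
      (∀ u ∈ D, u ∉ M → ∃ w ∈ M, G.Adj u w ∧ L u < L w) ∧
      ∀ K : ℕ,
        (∀ (x : V) (A : Finset V), (∀ a ∈ A, G.Adj x a) →
          (∀ a ∈ A, ∀ b ∈ A, a ≠ b → ¬ G.Adj a b) → A.card ≤ K) →
        M.card ≤ K := by
  obtain ⟨M, hMD, hind, hdom⟩ := G.exists_indep_dominating_subset hL D
  refine ⟨M, hMD, hind, hdom, fun K hK => hK v M (fun a ha => ?_) hind⟩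
  have haD := hMD ha
  rw [hD, Finset.mem_filter, SimpleGraph.mem_neighborFinset] at haD
  exact haD.1
end

section
/- Let G be a finite simple graph, let L : V → ℕ be an injective labeling, and suppose that for each vertex x we are given a set M(x) of neighbors of x, each with label smaller than L(x), satisfying: for every neighbor u of x with L(u) < L(x), either u ∈ M(x) or there exists w ∈ M(x) adjacent to u with L(u) < L(w). Then for every pair of adjacent vertices u, v with L(u) < L(v), there exist k ∈ ℕ and vertices w₀ = v, w₁, …, w_k such that w_{i+1} ∈ M(w_i) for all 0 ≤ i < k, the labels satisfy L(w₀) > L(w₁) > ⋯ > L(w_k) > L(u), each w_i with 1 ≤ i ≤ k is adjacent to u, and u ∈ M(w_k). -/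
/-- Propagation lemma: if every lower-labeled neighbor of each vertex `x` is either a
parent of `x` (member of `M x`) or adjacent to a parent of `x` with strictly larger label,
then for every edge `{u, v}` with `L u < L v` there is an oriented path
`v = w₀, w₁, …, w_k` of the parent relation with strictly decreasing labels staying
above `L u`, all `wᵢ` (for `i ≥ 1`) adjacent to `u`, and `u ∈ M (w_k)`. -/
theorem stmt_2 {V : Type*} [Fintype V] (G : SimpleGraph V)
    (L : V → ℕ) (hL : Function.Injective L) (M : V → Set V)
    (hM : ∀ x : V, ∀ u ∈ M x, G.Adj x u ∧ L u < L x)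
    (hdom : ∀ x u : V, G.Adj x u → L u < L x →
      u ∈ M x ∨ ∃ w ∈ M x, G.Adj w u ∧ L u < L w) :
    ∀ u v : V, G.Adj u v → L u < L v →
      ∃ (k : ℕ) (w : ℕ → V), w 0 = v ∧
        (∀ i < k, w (i + 1) ∈ M (w i)) ∧
        (∀ i < k, L (w (i + 1)) < L (w i)) ∧
        L u < L (w k) ∧
        (∀ i, 1 ≤ i → i ≤ k → G.Adj (w i) u) ∧
        u ∈ M (w k) := by
  intro u v huv hlt
  induction hn : L v using Nat.strong_induction_on generalizing v with
  | _ n ih =>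
    subst hn
    rcases hdom v u huv.symm hlt with hu | ⟨x, hx, hxu, hux⟩
    · exact ⟨0, fun _ => v, rfl, by simp, by simp, hlt, fun i h₁ h₀ => by omega, hu⟩
    · obtain ⟨k, w, h0, hpar, hdec, hlast, hadj, hu⟩ :=
        ih (L x) (hM v x hx).2 x hxu.symm hux rfl
      refine ⟨k + 1, fun i => Nat.casesOn i v w, rfl, ?_, ?_, hlast, ?_, hu⟩
      · rintro (_ | i) hi
        · simpa [h0] using hx
        · exact hpar i (by omega)
      · rintro (_ | i) hi
        · simpa [h0] using (hM v x hx).2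
        · exact hdec i (by omega)
      · rintro (_ | _ | i) h₁ hi
        · omega
        · simpa [h0] using hxu
        · exact hadj (i + 1) (by omega) (by omega)
end

section
/- Let G be a finite simple graph on vertex set V and let S ⊆ V. Let r₁ be a relation contained in the adjacency relation of G such that r₁(u,v) holds only when u ∉ S and v ∉ S, and r₁ is acyclic; let r₂ be a relation contained in the adjacency relation of G such that r₂(u,v) holds only when u ∈ S and v ∈ S, and r₂ is acyclic. Define a relation r on V by: r(u,v) if and only if u and v are adjacent in G and ( r₁(u,v) or r₂(u,v) or (u ∉ S and v ∈ S) ). Then r is acyclic. -/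
/-- A path in the combined relation stays outside `S`, stays inside `S`, or enters `S`. -/
theorem transGen_cases_of_directed_into {V : Type*} {S : Set V} {r r₁ r₂ : V → V → Prop}
    (h₁ : ∀ u v, r₁ u v → u ∉ S ∧ v ∉ S) (h₂ : ∀ u v, r₂ u v → u ∈ S ∧ v ∈ S)
    (hr : ∀ u v, r u v → r₁ u v ∨ r₂ u v ∨ (u ∉ S ∧ v ∈ S))
    {u v : V} (h : Relation.TransGen r u v) :
    (u ∉ S ∧ v ∉ S ∧ Relation.TransGen r₁ u v) ∨
      (u ∈ S ∧ v ∈ S ∧ Relation.TransGen r₂ u v) ∨ (u ∉ S ∧ v ∈ S) := by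
  induction h with
  | single h =>
    rcases hr _ _ h with h | h | h
    · exact Or.inl ⟨(h₁ _ _ h).1, (h₁ _ _ h).2, .single h⟩
    · exact Or.inr (Or.inl ⟨(h₂ _ _ h).1, (h₂ _ _ h).2, .single h⟩)
    · exact Or.inr (Or.inr h)
  | tail _ h ih =>
    rcases hr _ _ h with h | h | h
    · obtain ⟨hb, hc⟩ := h₁ _ _ h
      rcases ih with ⟨hu, _, p⟩ | ⟨_, hb', _⟩ | ⟨_, hb'⟩
      · exact Or.inl ⟨hu, hc, p.tail h⟩
      · exact absurd hb' hb
      · exact absurd hb' hb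
    · obtain ⟨hb, hc⟩ := h₂ _ _ h
      rcases ih with ⟨_, hb', _⟩ | ⟨hu, _, p⟩ | ⟨hu, _⟩
      · exact absurd hb hb'
      · exact Or.inr (Or.inl ⟨hu, hc, p.tail h⟩)
      · exact Or.inr (Or.inr ⟨hu, hc⟩)
    · obtain ⟨hb, hc⟩ := h
      rcases ih with ⟨hu, _, _⟩ | ⟨_, hb', _⟩ | ⟨_, hb'⟩
      · exact Or.inr (Or.inr ⟨hu, hc⟩)
      · exact absurd hb' hb
      · exact absurd hb' hb

/-- Combining an acyclic orientation `r₁` outside `S`, an acyclic orientation `r₂`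
inside `S`, and directing every edge between `V \ S` and `S` into `S`, yields an
acyclic orientation. -/
theorem stmt_3 {V : Type*} [Fintype V] (G : SimpleGraph V) (S : Set V)
    (r₁ r₂ : V → V → Prop)
    (h1adj : ∀ u v : V, r₁ u v → G.Adj u v)
    (h1S : ∀ u v : V, r₁ u v → u ∉ S ∧ v ∉ S)
    (h1ac : Irreflexive (Relation.TransGen r₁))
    (h2adj : ∀ u v : V, r₂ u v → G.Adj u v)
    (h2S : ∀ u v : V, r₂ u v → u ∈ S ∧ v ∈ S)
    (h2ac : Irreflexive (Relation.TransGen r₂)) :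
    Irreflexive (Relation.TransGen
      (fun u v : V => G.Adj u v ∧ (r₁ u v ∨ r₂ u v ∨ (u ∉ S ∧ v ∈ S)))) := by
  intro x hx
  rcases transGen_cases_of_directed_into h1S h2S (fun _ _ h => h.2) hx with
    ⟨_, _, p⟩ | ⟨_, _, p⟩ | ⟨hx₁, hx₂⟩
  · exact h1ac x p
  · exact h2ac x p
  · exact hx₁ hx₂
end
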